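/- arXiv:0908.3866 — 2 statements merged into one kernel-verified Lean document; each statement's English description precedes it below -/
import Mathlib

section
/- Let k ≥ 2 and d be positive integers with 2 ≤ d ≤ 3, and let d_{k,4} = d·(4^k − 1)/3. Then there exists a positive integer x with (d^k)^2 + x^2 = (d_{k,4})^2 if and only if k = 2 and d = 3. In that case the triangle has side lengths 9, 12, and 15. -/
lemma aux_dvd (k a : ℕ) (hk : 2 ≤ k) (h : 3 ^ a ∣ 4 ^ k - 1) : 3 ^ a ∣ 3 * k := by
  have : Fact (Nat.Prime 3) := ⟨Nat.prime_three⟩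
  have h1 := padicValNat.pow_sub_pow (p := 3) (x := 4) (y := 1) (by decide) (by decide)
    (by decide) (by decide) (n := k) (by omega)
  rw [one_pow] at h1
  have h4 : 4 ^ 1 ≤ 4 ^ k := Nat.pow_le_pow_right (by norm_num) (by omega)
  have h2 := (padicValNat_dvd_iff_le (p := 3) (a := 4 ^ k - 1) (by omega)).1 h
  have h3 : padicValNat 3 (3 * k) = padicValNat 3 3 + padicValNat 3 k :=
    padicValNat.mul (by norm_num) (by omega)
  apply (padicValNat_dvd_iff_le (p := 3) (by omega)).2
  rw [h3]
  rw [h1] at h2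
  exact h2

lemma aux_size (k : ℕ) (hk : 4 ≤ k) : 6 * k * 4 ^ k < 9 ^ k := by
  induction k, hk using Nat.le_induction with
  | base => norm_num
  | succ n hn ih =>
    have : 0 < 4 ^ n := by positivity
    rw [pow_succ, pow_succ]
    nlinarith

lemma aux_three (k x : ℕ) (hk : 2 ≤ k) (h : (3 ^ k) ^ 2 + x ^ 2 = (4 ^ k - 1) ^ 2) : k = 2 := by
  have h4 : 4 ^ 2 ≤ 4 ^ k := Nat.pow_le_pow_right (by norm_num) hk
  obtain ⟨N, hN⟩ : ∃ N, N = 4 ^ k - 1 := ⟨_, rfl⟩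
  have hN4 : 4 ^ k = N + 1 := by omega
  rw [← hN] at h
  have h3 : 0 < 3 ^ k := by positivity
  have hx : x < N := by nlinarith
  obtain ⟨u, hu⟩ : ∃ u, N = x + u := ⟨N - x, by omega⟩
  have hprod : u * (N + x) = 3 ^ (2 * k) := by
    rw [mul_comm 2 k, pow_mul]
    subst hu
    nlinarith
  obtain ⟨a, ha, hua⟩ := (Nat.dvd_prime_pow Nat.prime_three).1 (Dvd.intro _ hprod)
  obtain ⟨b, hb, hvb⟩ := (Nat.dvd_prime_pow Nat.prime_three).1 (Dvd.intro_left _ hprod)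
  have hab : a ≤ b := by
    apply (Nat.pow_le_pow_iff_right (a := 3) (by norm_num)).1
    omega
  have hd : 3 ^ a ∣ 2 * N := by
    have e : 2 * N = 3 ^ a + 3 ^ b := by omega
    rw [e]
    exact dvd_add dvd_rfl (pow_dvd_pow 3 hab)
  have hd2 : 3 ^ a ∣ 4 ^ k - 1 := by
    rw [← hN]
    exact (Nat.Coprime.pow_left a (by norm_num)).dvd_of_dvd_mul_left hd
  have hle : 3 ^ a ≤ 3 * k := Nat.le_of_dvd (by omega) (aux_dvd k a hk hd2)
  rw [← hua] at hle
  have hk4 : k < 4 := by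
    by_contra hc
    have hs := aux_size k (by omega)
    have e9 : (9 : ℕ) ^ k = 3 ^ (2 * k) := by rw [pow_mul]; norm_num
    rw [e9, ← hprod, hN4] at hs
    have : u * (N + x) ≤ (3 * k) * (2 * (N + 1)) := Nat.mul_le_mul hle (by omega)
    nlinarith
  have : k = 2 ∨ k = 3 := by omega
  rcases this with rfl | rfl
  · rfl
  · exfalso
    norm_num at hN
    subst hN
    norm_num at h
    have h1 : 56 < x := by nlinarith
    have h2 : x < 57 := by nlinarith
    omega

/-- Theorem 2 (base 4, Type 1): for `k ≥ 2` and `2 ≤ d ≤ 3`, there is a positive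
integer `x` with `(d^k)^2 + x^2 = (d_{k,4})^2` (where `d_{k,4} = d·(4^k − 1)/3`)
iff `k = 2` and `d = 3`; in that case the triangle has sides 9, 12, 15. -/
theorem type1_base4_iff (k d : ℕ) (hk : 2 ≤ k) (hd2 : 2 ≤ d) (hd3 : d ≤ 3) :
    (∃ x : ℕ, 0 < x ∧ (d ^ k) ^ 2 + x ^ 2 = (d * (4 ^ k - 1) / 3) ^ 2) ↔
      (k = 2 ∧ d = 3 ∧ d ^ k = 9 ∧ d * (4 ^ k - 1) / 3 = 15 ∧ 9 ^ 2 + 12 ^ 2 = 15 ^ 2) := by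
  constructor
  · rintro ⟨x, hx0, hx⟩
    have hd : d = 2 ∨ d = 3 := by omega
    rcases hd with rfl | rfl
    · exfalso
      have h4 : 4 ^ 2 ≤ 4 ^ k := Nat.pow_le_pow_right (by norm_num) hk
      have hdv : 3 ∣ 4 ^ k - 1 := by
        simpa using Nat.sub_dvd_pow_sub_pow 4 1 k
      obtain ⟨R, hR⟩ := hdv
      have e : 2 * (4 ^ k - 1) / 3 = 2 * R := by omega
      have e2 : ((2 : ℕ) ^ k) ^ 2 = 3 * R + 1 := by
        rw [← pow_mul, mul_comm, pow_mul]
        norm_num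
        omega
      rw [e, e2] at hx
      have h1 : x < 2 * R := by nlinarith
      have h2 : 2 * R < x + 1 := by
        by_contra hc
        have hR5 : 5 ≤ R := by omega
        obtain ⟨S, hS⟩ : ∃ S, 2 * R = S + 1 := ⟨2 * R - 1, by omega⟩
        have hxS : x * x ≤ S * S := Nat.mul_le_mul (by omega) (by omega)
        rw [hS] at hx
        nlinarith
      omega
    · have e : 3 * (4 ^ k - 1) / 3 = 4 ^ k - 1 := by omega
      rw [e] at hx
      have := aux_three k x hk hx
      subst this
      norm_num
  · rintro ⟨rfl, rfl, -⟩
    exact ⟨12, by norm_num, by norm_num⟩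
end

section
/- For every integer k ≥ 2, there is no positive integer x with (2^k)^2 + x^2 = (3^k − 1)^2; i.e., there is no Pythagorean triangle with one leg of length 2^k and hypotenuse of length 3^k − 1. -/
theorem aux_val (k : ℕ) : ∀ m : ℕ, 1 ≤ k → 2 ^ m ∣ 3 ^ k - 1 → 2 ^ m ≤ 4 * k := by
  induction k using Nat.strong_induction_on with
  | _ k ih =>
    intro m hk hd
    rcases Nat.even_or_odd' k with ⟨j, rfl | rfl⟩
    · rcases Nat.even_or_odd' j with ⟨i, rfl | rfl⟩
      · -- the exponent is divisible by four
        have h9 : 3 ^ (2 * i) % 4 = 1 := by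
          rw [pow_mul, Nat.pow_mod]; norm_num
        rcases m with _ | m
        · simp; omega
        have h := ih (2 * i) (by omega) m (by omega) (by
          set y := 3 ^ (2 * i) with hy
          have e : 3 ^ (2 * (2 * i)) - 1 = 2 * ((y - 1) * ((y + 1) / 2)) := by
            rw [mul_comm 2 (2 * i), pow_mul, ← hy]
            obtain ⟨c, hc⟩ : ∃ c, y = 4 * c + 1 := ⟨y / 4, by omega⟩
            have h1 : (y + 1) / 2 = 2 * c + 1 := by omega
            have h2 : y - 1 = 4 * c := by omega
            rw [h1, h2, hc]
            apply Nat.sub_eq_of_eq_add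
            ring
          rw [e, pow_succ, mul_comm (2 ^ m) 2] at hd
          have hd2 := Nat.dvd_of_mul_dvd_mul_left (by norm_num) hd
          refine Nat.Coprime.dvd_of_dvd_mul_right ?_ hd2
          apply Nat.Coprime.pow_left
          rw [Nat.coprime_two_left, Nat.odd_iff]
          omega)
        rw [pow_succ]; omega
      · have h9 : 3 ^ (2 * (2 * i + 1)) % 16 = 9 := by
          rw [show 2 * (2 * i + 1) = 4 * i + 2 by ring, pow_add, pow_mul, Nat.mul_mod, Nat.pow_mod]
          norm_num
        by_contra hc
        have : 4 ≤ m := by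
          by_contra h
          have : 2 ^ m ≤ 2 ^ 3 := Nat.pow_le_pow_right (by norm_num) (by omega)
          omega
        have := (pow_dvd_pow 2 this).trans hd
        clear hd hc
        generalize 3 ^ (2 * (2 * i + 1)) = y at *
        norm_num at this
        omega
    · have h9 : 3 ^ (2 * j + 1) % 4 = 3 := by
        rw [pow_add, pow_mul, Nat.mul_mod, Nat.pow_mod]
        norm_num
      by_contra hc
      have : 2 ≤ m := by
        by_contra h
        have : 2 ^ m ≤ 2 ^ 1 := Nat.pow_le_pow_right (by norm_num) (by omega)
        omega
      have := (pow_dvd_pow 2 this).trans hd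
      clear hd hc
      generalize 3 ^ (2 * j + 1) = y at *
      norm_num at this
      omega

theorem aux_growth (k : ℕ) (hk : 21 ≤ k) : 16 * k * 3 ^ k ≤ 4 ^ k := by
  induction k, hk using Nat.le_induction with
  | base => norm_num
  | succ k hk ih =>
    rw [pow_succ, pow_succ]
    have hp := Nat.mul_le_mul_right (3 ^ k) hk
    generalize 3 ^ k = p at *
    generalize 4 ^ k = q at *
    nlinarith

theorem aux_small : ∀ k < 21, ∀ m < 40, 2 ≤ k → m ≤ 2 * k - 2 →
    3 ^ k ≠ 1 + 2 ^ m + 2 ^ (2 * k - 2 - m) := by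
  decide +kernel

/-- Theorem 4 (base 3, Type 1): for `k ≥ 2`, there is no positive integer `x`
with `(2^k)^2 + x^2 = (3^k − 1)^2`. -/
theorem no_type1_base3 (k : ℕ) (hk : 2 ≤ k) :
    ¬ ∃ x : ℕ, 0 < x ∧ (2 ^ k) ^ 2 + x ^ 2 = (3 ^ k - 1) ^ 2 := by
  rintro ⟨x, hx, h⟩
  have h3 : 1 < 3 ^ k := Nat.one_lt_pow (by omega) (by norm_num)
  obtain ⟨H, hH⟩ : ∃ H, H = 3 ^ k - 1 := ⟨_, rfl⟩
  rw [← hH] at h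
  have hp : 0 < 2 ^ k := by positivity
  have hlt : x < H := by
    by_contra hc
    have := Nat.pow_le_pow_left (not_lt.mp hc) 2
    have : 0 < (2 ^ k) ^ 2 := by positivity
    omega
  obtain ⟨u, rfl⟩ := Nat.exists_eq_add_of_lt hlt
  have hf : (u + 1) * (2 * x + u + 1) = 2 ^ (2 * k) := by
    rw [mul_comm 2 k, pow_mul]; nlinarith
  obtain ⟨a, -, ha⟩ := (Nat.dvd_prime_pow Nat.prime_two).1 (Dvd.intro _ hf)
  obtain ⟨b, -, hb⟩ := (Nat.dvd_prime_pow Nat.prime_two).1 (Dvd.intro_left _ hf)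
  rw [ha, hb, ← pow_add] at hf
  have hab := Nat.pow_right_injective (le_refl 2) hf
  have hltab : a < b := (Nat.pow_lt_pow_iff_right (a := 2) (by norm_num)).1 (by omega)
  rcases b with _ | n
  · omega
  rcases a with _ | m
  · rw [pow_succ] at hb
    simp at ha
    omega
  rw [pow_succ] at ha hb
  have hs : 3 ^ k = 1 + 2 ^ m + 2 ^ n := by omega
  have hn : n = 2 * k - 2 - m := by omega
  by_cases hk21 : k < 21
  · exact aux_small k hk21 m (by omega) hk (by omega) (hn ▸ hs)
  · have hv := aux_val k m (by omega) (by
      rw [show 3 ^ k - 1 = 2 ^ m + 2 ^ n by omega]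
      exact dvd_add dvd_rfl (pow_dvd_pow 2 (by omega)))
    have hg := aux_growth k (by omega)
    have e : 4 ^ k = 4 * (2 ^ m * 2 ^ n) := by
      rw [← pow_add, show (4 : ℕ) = 2 ^ 2 by norm_num, ← pow_mul, ← pow_add]
      congr 1; omega
    have h1 : 2 ^ m * 2 ^ n ≤ 4 * k * 2 ^ n := Nat.mul_le_mul_right _ hv
    have h2 : k * 2 ^ n < k * 3 ^ k := Nat.mul_lt_mul_of_pos_left (by omega) (by omega)
    nlinarith
end
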